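/- Generically a variety is a complete intersection: let 1 ≤ r ≤ n and d ≥ 1. The set of r-tuples (p₁,…,p_r) of polynomials in A = ℂ[x₁,…,xₙ], each of total degree at most d, such that the ideal (p₁,…,p_r) ⊆ A has height exactly r, contains a nonempty Zariski-open subset of the parameter space; that is, there exists a nonzero polynomial F in N = r·(n+d choose n) variables such that every r-tuple of polynomials of degree at most d whose coefficient vector is not a zero of F generates an ideal of height r. -/

import Mathlib

noncomputable section

/-- The height of an ideal `I`: the infimum of the heights of the prime ideals minimal
over `I` (so the unit ideal, having no minimal primes, has height `⊤`). -/
noncomputable def idealHeight {R : Type*} [CommRing R] (I : Ideal R) : ℕ∞ :=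
  ⨅ p : {q : PrimeSpectrum R // q.asIdeal ∈ I.minimalPrimes}, Order.height p.1

/-- The coefficient vector of an `r`-tuple of polynomials of degree at most `d`, giving the
identification of the set of such tuples with the affine space `ℂ^N`,
`N = r·(n+d choose n)`. -/
def tupleCoeffs {n r d : ℕ} (p : Fin r → MvPolynomial (Fin n) ℂ) :
    Fin r × {m : Fin n →₀ ℕ // m.degree ≤ d} → ℂ :=
  fun v => MvPolynomial.coeff v.2.1 (p v.1)

open MvPolynomial

noncomputable def evz (n k : ℕ) : MvPolynomial (Fin n) ℂ →ₐ[ℂ] MvPolynomial (Fin n) ℂ :=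
  aeval (fun i => if i.val < k then 0 else X i)

lemma evz_comp (n k : ℕ) : (evz n (k+1)).comp (evz n k) = evz n (k+1) := by
  ext1 i
  simp only [evz, AlgHom.comp_apply, aeval_X]
  split_ifs <;> simp_all <;> omega

lemma height_ker_evz (n k : ℕ) (hk : k ≤ n) :
    (k : ℕ∞) ≤ (RingHom.ker (evz n k)).height := by
  induction k with
  | zero => simp
  | succ k ih =>
    have h1 : (RingHom.ker (evz n k)).IsPrime := RingHom.ker_isPrime _
    have h2 : (RingHom.ker (evz n (k+1))).IsPrime := RingHom.ker_isPrime _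
    have hlt : RingHom.ker (evz n k) < RingHom.ker (evz n (k+1)) := by
      refine SetLike.lt_iff_le_and_exists.2 ⟨?_, X ⟨k, hk⟩, ?_, ?_⟩
      · intro f hf
        rw [RingHom.mem_ker] at hf ⊢
        rw [← evz_comp, AlgHom.comp_apply, hf, map_zero]
      · simp [RingHom.mem_ker, evz]
      · simp [RingHom.mem_ker, evz]
    have := Ideal.height_add_one_le_of_lt_of_isPrime hlt
    push_cast
    exact le_trans (by gcongr; exact ih (by omega)) this

lemma ker_evz_le (n r : ℕ) (Q : Ideal (MvPolynomial (Fin n) ℂ))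
    (hQ : ∀ i : Fin n, i.val < r → X i ∈ Q) : RingHom.ker (evz n r) ≤ Q := by
  have : (Ideal.Quotient.mkₐ ℂ Q).comp (evz n r) = Ideal.Quotient.mkₐ ℂ Q := by
    ext1 i
    simp only [evz, AlgHom.comp_apply, aeval_X]
    split_ifs with h
    · rw [map_zero]
      exact (Ideal.Quotient.eq_zero_iff_mem.2 (hQ i h)).symm
    · rfl
  intro f hf
  rw [RingHom.mem_ker] at hf
  rw [← Ideal.Quotient.eq_zero_iff_mem]
  change Ideal.Quotient.mkₐ ℂ Q f = 0
  rw [← this, AlgHom.comp_apply, hf, map_zero]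

lemma main_alg {S : Type} [CommRing S] [IsDomain S] [IsNoetherianRing S] [Algebra ℂ S]
    (n r : ℕ) (hrn : r ≤ n) (q : Fin n → S)
    (hint : Algebra.IsIntegral (Algebra.adjoin ℂ (Set.range q)) S)
    (htr : Algebra.trdeg ℂ S = n) :
    Ideal.span {x | ∃ i : Fin n, i.val < r ∧ q i = x} ≠ ⊤ ∧
    ∀ P : Ideal S, P.IsPrime → (∀ i : Fin n, i.val < r → q i ∈ P) → (r : ℕ∞) ≤ P.height := by
  have hb : IsTranscendenceBasis ℂ q :=
    Algebra.IsAlgebraic.isTranscendenceBasis_of_le_trdeg_of_finite ℂ q (by simp [htr])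
  have hinj : Function.Injective (aeval q : MvPolynomial (Fin n) ℂ →ₐ[ℂ] S) := hb.1
  let alg : Algebra (MvPolynomial (Fin n) ℂ) S :=
    (aeval q : MvPolynomial (Fin n) ℂ →ₐ[ℂ] S).toRingHom.toAlgebra
  have hmap : ∀ f, algebraMap (MvPolynomial (Fin n) ℂ) S f = aeval q f := fun f => rfl
  have : FaithfulSMul (MvPolynomial (Fin n) ℂ) S :=
    (faithfulSMul_iff_algebraMap_injective _ _).2 hinj
  have : Algebra.IsIntegral (MvPolynomial (Fin n) ℂ) S := by
    constructor
    intro x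
    obtain ⟨p, hpm, hp⟩ := hint.isIntegral x
    have hsurj : Function.Surjective (hb.1.aevalEquiv) := hb.1.aevalEquiv.surjective
    refine ⟨p.map (hb.1.aevalEquiv.symm : _ →+* _), hpm.map _, ?_⟩
    rw [Polynomial.eval₂_map]
    convert hp using 2
    ext y
    obtain ⟨y, rfl⟩ := hsurj y
    simp [hmap]
  constructor
  · intro htop
    have hk : RingHom.ker (evz n r) ≠ ⊤ := RingHom.ker_ne_top _
    have h1 : (RingHom.ker (evz n r)).IsPrime := RingHom.ker_isPrime _
    obtain ⟨P, hP, hP'⟩ := Ideal.exists_ideal_over_prime_of_isIntegral_of_isDomain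
      (S := S) (RingHom.ker (evz n r)) (by
        rw [(RingHom.injective_iff_ker_eq_bot (algebraMap (MvPolynomial (Fin n) ℂ) S)).1 hinj]
        exact bot_le)
    apply hP.ne_top
    rw [eq_top_iff, ← htop, Ideal.span_le]
    rintro x ⟨i, hi, rfl⟩
    have : X i ∈ RingHom.ker (evz n r) := by simp [RingHom.mem_ker, evz, hi]
    rw [← hP', Ideal.mem_comap, hmap, aeval_X] at this
    exact this
  · intro P hP hq
    have : P.LiesOver (P.under (MvPolynomial (Fin n) ℂ)) := ⟨rfl⟩
    have h := Ideal.height_eq_height_add_of_liesOver_of_hasGoingDown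
      (P.under (MvPolynomial (Fin n) ℂ)) P
    have h3 : (r : ℕ∞) ≤ (P.under (MvPolynomial (Fin n) ℂ)).height := by
      refine (height_ker_evz n r hrn).trans (Ideal.height_mono (ker_evz_le n r _ ?_))
      intro i hi
      rw [Ideal.mem_comap, hmap, aeval_X]
      exact hq i hi
    rw [h]
    exact h3.trans le_self_add

lemma exists_sub_degree {n : ℕ} (m : Fin n →₀ ℕ) (D : ℕ) (h : D ≤ m.degree) :
    ∃ m0 m1 : Fin n →₀ ℕ, m = m0 + m1 ∧ m0.degree = D := by
  induction D with
  | zero => exact ⟨0, m, by simp, by simp⟩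
  | succ D ih =>
    obtain ⟨m0, m1, rfl, h0⟩ := ih (by omega)
    have hm1 : m1 ≠ 0 := by
      rintro rfl
      simp at h
      omega
    obtain ⟨i, hi⟩ := Finsupp.ne_iff.1 hm1
    refine ⟨m0 + Finsupp.single i 1, m1 - Finsupp.single i 1, ?_, by simp [h0]⟩
    rw [add_assoc, add_tsub_cancel_of_le]
    rw [Finsupp.single_le_iff]
    simp at hi
    omega

lemma degree_le_totalDegree {n : ℕ} {f : MvPolynomial (Fin n) ℂ} {m : Fin n →₀ ℕ}
    (h : m ∈ f.support) : m.degree ≤ f.totalDegree := le_totalDegree h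

lemma totalDegree_mon {n : ℕ} (m : Fin n →₀ ℕ) (c : ℂ) :
    (monomial m c).totalDegree ≤ m.degree := totalDegree_monomial_le m c

lemma totalDegree_lt_of {n : ℕ} {f : MvPolynomial (Fin n) ℂ} {D : ℕ} (hD : 0 < D)
    (h : ∀ m : Fin n →₀ ℕ, D ≤ m.degree → coeff m f = 0) : f.totalDegree < D := by
  rw [totalDegree, Finset.sup_lt_iff (by simpa using hD)]
  intro m hm
  by_contra hc
  exact (mem_support_iff.1 hm) (h m (not_lt.1 hc))

lemma integral_of_reduce {n D : ℕ} (q : Fin n → MvPolynomial (Fin n) ℂ)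
    {T : Type} [Fintype T] (idx : T → Fin n)
    (H : ∀ m0 : Fin n →₀ ℕ, m0.degree = D → ∃ h : T → MvPolynomial (Fin n) ℂ,
      (∀ t, (h t).totalDegree < D) ∧
      (monomial m0 1 - ∑ t, h t * q (idx t)).totalDegree < D) :
    Algebra.IsIntegral (Algebra.adjoin ℂ (Set.range q)) (MvPolynomial (Fin n) ℂ) := by
  let S := Algebra.adjoin ℂ (Set.range q)
  let M : Set (MvPolynomial (Fin n) ℂ) :=
    (fun m => monomial m (1 : ℂ)) '' {m : Fin n →₀ ℕ | m.degree < D}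
  let N : Submodule S (MvPolynomial (Fin n) ℂ) := Submodule.span S M
  have hC : ∀ (c : ℂ) (f : MvPolynomial (Fin n) ℂ), f ∈ N → C c * f ∈ N := by
    intro c f hf
    have := N.smul_mem (algebraMap ℂ S c) hf
    rwa [Algebra.smul_def] at this
  have hq : ∀ (i : Fin n) (f : MvPolynomial (Fin n) ℂ), f ∈ N → f * q i ∈ N := by
    intro i f hf
    have := N.smul_mem (⟨q i, Algebra.subset_adjoin ⟨i, rfl⟩⟩ : S) hf
    rw [Algebra.smul_def, mul_comm] at this
    exact this
  have key : ∀ k : ℕ, ∀ f : MvPolynomial (Fin n) ℂ, f.totalDegree ≤ k → f ∈ N := by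
    intro k
    induction k using Nat.strong_induction_on with
    | _ k ih =>
    intro f hf
    rw [f.as_sum]
    refine N.sum_mem fun m hm => ?_
    have hmk : m.degree ≤ k := (degree_le_totalDegree hm).trans hf
    rw [show monomial m (coeff m f) = C (coeff m f) * monomial m 1 by
      rw [C_mul_monomial, mul_one]]
    refine hC _ _ ?_
    by_cases hmD : m.degree < D
    · exact Submodule.subset_span ⟨m, hmD, rfl⟩
    obtain ⟨m0, m1, rfl, h0⟩ := exists_sub_degree m D (not_lt.1 hmD)
    obtain ⟨h, hh, hr⟩ := H m0 h0
    rw [map_add, h0] at hmk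
    have hm1 := totalDegree_mon m1 (1 : ℂ)
    have e : monomial (m0 + m1) (1 : ℂ) =
        monomial m1 1 * (monomial m0 1 - ∑ t, h t * q (idx t)) +
          ∑ t, (monomial m1 1 * h t) * q (idx t) := by
      rw [show monomial (m0 + m1) (1 : ℂ) = monomial m1 1 * monomial m0 1 by
        rw [monomial_mul, add_comm, mul_one], mul_sub, Finset.mul_sum]
      simp only [mul_assoc, sub_add_cancel]
    rw [e]
    refine N.add_mem ?_ (N.sum_mem fun t _ => hq _ _ ?_)
    · refine ih (k - 1) (by omega) _ ?_
      have := totalDegree_mul (monomial m1 (1 : ℂ)) (monomial m0 1 - ∑ t, h t * q (idx t))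
      omega
    · refine ih (k - 1) (by have := hh t; omega) _ ?_
      have := totalDegree_mul (monomial m1 (1 : ℂ)) (h t)
      have := hh t
      omega
  have hfin : Module.Finite S (MvPolynomial (Fin n) ℂ) := by
    have hMf : M.Finite := (Finsupp.finite_of_degree_lt D).image _
    refine ⟨⟨hMf.toFinset, ?_⟩⟩
    rw [Set.Finite.coe_toFinset]
    exact eq_top_iff.2 fun f _ => key _ f le_rfl
  exact Algebra.IsIntegral.of_finite _ _

lemma exists_G (n d : ℕ) (hn : 1 ≤ n) (hd : 1 ≤ d) :
    ∃ G : MvPolynomial (Fin n × {m : Fin n →₀ ℕ // m.degree ≤ d}) ℂ,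
      eval (tupleCoeffs (d := d) (fun i : Fin n => (X i ^ d : MvPolynomial (Fin n) ℂ))) G ≠ 0 ∧
      ∀ q : Fin n → MvPolynomial (Fin n) ℂ, (∀ i, (q i).totalDegree ≤ d) →
        eval (tupleCoeffs (d := d) q) G ≠ 0 →
        Algebra.IsIntegral (Algebra.adjoin ℂ (Set.range q)) (MvPolynomial (Fin n) ℂ) := by
  classical
  let T := {m : Fin n →₀ ℕ // m.degree = n * d}
  have hDpos : 0 < n * d := Nat.mul_pos hn hd
  have hfinT : Finite T := (Finsupp.finite_of_degree_eq (n * d)).to_subtype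
  have : Fintype T := Fintype.ofFinite T
  have hex : ∀ t : T, ∃ i : Fin n, d ≤ t.1 i := by
    rintro ⟨m, hm⟩
    by_contra! hc
    have h1 : ∑ i, m i < ∑ _i : Fin n, d :=
      Finset.sum_lt_sum_of_nonempty ⟨⟨0, hn⟩, Finset.mem_univ _⟩ fun i _ => hc i
    rw [Finsupp.degree_eq_sum] at hm
    simp at h1
    omega
  choose idx hidx using hex
  let s : T → (Fin n →₀ ℕ) := fun t => t.1 - Finsupp.single (idx t) d
  have hs : ∀ t, s t + Finsupp.single (idx t) d = t.1 := fun t =>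
    tsub_add_cancel_of_le (Finsupp.single_le_iff.2 (hidx t))
  have hsd : ∀ t, (s t).degree + d = n * d := by
    intro t
    have := congrArg Finsupp.degree (hs t)
    rw [map_add, Finsupp.degree_single, t.2] at this
    exact this
  have hdeg : ∀ t t' : T, s t ≤ t'.1 → (t'.1 - s t).degree ≤ d := by
    intro t t' h
    have := congrArg Finsupp.degree (tsub_add_cancel_of_le h)
    rw [map_add, t'.2] at this
    have := hsd t
    omega
  let Mat : Matrix T T (MvPolynomial (Fin n × {m : Fin n →₀ ℕ // m.degree ≤ d}) ℂ) :=
    fun t t' => if h : s t ≤ t'.1 then X (idx t, ⟨t'.1 - s t, hdeg t t' h⟩) else 0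
  let E (q : Fin n → MvPolynomial (Fin n) ℂ) : Matrix T T ℂ :=
    fun t t' => coeff t'.1 (monomial (s t) 1 * q (idx t))
  have hE : ∀ q, eval (tupleCoeffs (d := d) q) Mat.det = (E q).det := by
    intro q
    rw [RingHom.map_det]
    congr 1
    ext t t'
    rw [RingHom.mapMatrix_apply, Matrix.map_apply]
    simp only [Mat, E, coeff_monomial_mul']
    split_ifs with h
    · simp [tupleCoeffs]
    · simp
  refine ⟨Mat.det, ?_, ?_⟩
  · rw [hE]
    have : E (fun i => X i ^ d) = 1 := by
      ext t t'
      simp only [E, X_pow_eq_monomial, monomial_mul, hs, mul_one, coeff_monomial,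
        Matrix.one_apply]
      simp only [← Subtype.ext_iff]
    rw [this, Matrix.det_one]
    exact one_ne_zero
  · intro q hq hne
    rw [hE] at hne
    have hinv : (E q)⁻¹ * E q = 1 := Matrix.nonsing_inv_mul _ (isUnit_iff_ne_zero.2 hne)
    refine integral_of_reduce (D := n * d) q idx fun m0 hm0 => ?_
    refine ⟨fun t => C ((E q)⁻¹ ⟨m0, hm0⟩ t) * monomial (s t) 1, fun t => ?_, ?_⟩
    · change (C ((E q)⁻¹ ⟨m0, hm0⟩ t) * monomial (s t) 1).totalDegree < n * d
      rw [C_mul_monomial]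
      have := totalDegree_mon (s t) ((E q)⁻¹ ⟨m0, hm0⟩ t * 1)
      have := hsd t
      omega
    · refine totalDegree_lt_of hDpos fun m hm => ?_
      rw [coeff_sub, coeff_sum, coeff_monomial]
      simp only [mul_assoc, coeff_C_mul]
      rcases hm.eq_or_lt with h | h
      · have h2 := congrFun (congrFun hinv ⟨m0, hm0⟩) ⟨m, h.symm⟩
        rw [Matrix.mul_apply, Matrix.one_apply] at h2
        simp only [Subtype.ext_iff] at h2
        exact sub_eq_zero.2 h2.symm
      · rw [if_neg (by rintro rfl; omega), zero_sub, neg_eq_zero]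
        refine Finset.sum_eq_zero fun t _ => ?_
        rw [notMem_support_iff.1, mul_zero]
        intro hmem
        have h1 := degree_le_totalDegree hmem
        have h2 := totalDegree_mul (monomial (s t) (1 : ℂ)) (q (idx t))
        have h3 := totalDegree_mon (s t) (1 : ℂ)
        have h4 := hq (idx t)
        have h5 := hsd t
        omega

/-- Generically a variety is a complete intersection: for `1 ≤ r ≤ n` and `d ≥ 1`, the set of
`r`-tuples of polynomials of degree at most `d` in `A = ℂ[x₁, …, xₙ]` generating an ideal of
height exactly `r` contains a nonempty Zariski-open subset of the parameter space
`ℂ^N`, `N = r·(n+d choose n)`. -/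
theorem generic_complete_intersection (n r d : ℕ) (hr : 1 ≤ r) (hrn : r ≤ n) (hd : 1 ≤ d) :
    ∃ F : MvPolynomial (Fin r × {m : Fin n →₀ ℕ // m.degree ≤ d}) ℂ,
      F ≠ 0 ∧
      ∀ p : Fin r → MvPolynomial (Fin n) ℂ,
        (∀ i, (p i).totalDegree ≤ d) →
        MvPolynomial.eval (tupleCoeffs (d := d) p) F ≠ 0 →
        idealHeight (Ideal.span (Set.range p)) = (r : ℕ∞) := by
  have hn : 1 ≤ n := hr.trans hrn
  obtain ⟨G, hG, hGq⟩ := exists_G n d hn hd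
  let ext (p : Fin r → MvPolynomial (Fin n) ℂ) : Fin n → MvPolynomial (Fin n) ℂ :=
    fun i => if h : i.val < r then p ⟨i.val, h⟩ else X i ^ d
  let F : MvPolynomial (Fin r × {m : Fin n →₀ ℕ // m.degree ≤ d}) ℂ :=
    aeval (fun v : Fin n × {m : Fin n →₀ ℕ // m.degree ≤ d} =>
      if h : v.1.val < r then (X (⟨v.1.val, h⟩, v.2) :
        MvPolynomial (Fin r × {m : Fin n →₀ ℕ // m.degree ≤ d}) ℂ)
      else C (coeff v.2.1 (X v.1 ^ d : MvPolynomial (Fin n) ℂ))) G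
  have hF : ∀ p, eval (tupleCoeffs (d := d) p) F = eval (tupleCoeffs (d := d) (ext p)) G := by
    intro p
    have hcomp : (eval (tupleCoeffs (d := d) p)).comp
        ((aeval (fun v : Fin n × {m : Fin n →₀ ℕ // m.degree ≤ d} =>
          if h : v.1.val < r then (X (⟨v.1.val, h⟩, v.2) :
            MvPolynomial (Fin r × {m : Fin n →₀ ℕ // m.degree ≤ d}) ℂ)
          else C (coeff v.2.1 (X v.1 ^ d : MvPolynomial (Fin n) ℂ))) :
            _ →ₐ[ℂ] _) : _ →+* _) = eval (tupleCoeffs (d := d) (ext p)) := by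
      apply MvPolynomial.ringHom_ext
      · intro c
        simp [MvPolynomial.algebraMap_eq]
      · intro v
        simp only [RingHom.comp_apply, RingHom.coe_coe, aeval_X, eval_X]
        simp only [tupleCoeffs, ext]
        split_ifs <;> simp [tupleCoeffs]
    exact congrArg (fun φ => φ G) hcomp
  refine ⟨F, ?_, ?_⟩
  · intro h0
    apply hG
    have h1 := hF (fun i => X ⟨i.val, i.2.trans_le hrn⟩ ^ d)
    rw [h0, map_zero] at h1
    rw [h1]
    congr 2
    funext i
    simp [ext]
  · intro p hp hne
    rw [hF] at hne
    have hint := hGq (ext p) (fun i => by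
      simp only [ext]
      split_ifs
      · exact hp _
      · simp) hne
    obtain ⟨hI, hP⟩ := main_alg n r hrn (ext p) hint (by
      rw [MvPolynomial.trdeg_of_isDomain]; simp)
    have hset : {x | ∃ i : Fin n, i.val < r ∧ ext p i = x} = Set.range p := by
      ext x
      constructor
      · rintro ⟨i, hi, rfl⟩
        exact ⟨⟨i, hi⟩, by simp [ext, hi]⟩
      · rintro ⟨i, rfl⟩
        exact ⟨⟨i, i.2.trans_le hrn⟩, i.2, by simp [ext]⟩
    rw [hset] at hI
    unfold idealHeight
    apply le_antisymm
    · obtain ⟨P, hPm⟩ := Ideal.nonempty_minimalPrimes hI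
      refine (iInf_le _ ⟨⟨P, hPm.isPrime⟩, hPm⟩).trans ?_
      rw [← PrimeSpectrum.height_eq_orderHeight]
      refine (Ideal.height_le_card_of_mem_minimalPrimes_span (Set.finite_range p) hPm).trans ?_
      have := Set.ncard_image_le (f := p) (Set.finite_univ (α := Fin r))
      rw [Set.image_univ, Set.ncard_univ, Nat.card_fin] at this
      exact_mod_cast this
    · refine le_iInf fun P => ?_
      rw [← PrimeSpectrum.height_eq_orderHeight]
      refine hP _ P.1.2 fun i hi => ?_
      apply P.2.1.2
      rw [← hset]
      exact Ideal.subset_span ⟨i, hi, rfl⟩
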